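/- (Theorem 2) Under the stepsize condition α ≤ min{(1 + λ_n(W))/L_h, 1/L_f̄} and β < 1, assuming ξ_α attains its minimum at some [x̃_{(i)}] ∈ (ℝ^p)^n and fixing any x* ∈ X*, with C := (1/√n)(‖[x̃_{(i)}]‖ + ‖[x̃_{(i)} − x*]‖), the mean objective error satisfies the recursive inequality for all k ≥ 0: r̄(k+1) ≤ r̄(k) − (α/(2C²)) r̄(k)² + α³ D² L_h² / (2(1 − β)²). In particular, while r̄(k) > C√2 · α L_h D/(1 − β), one has r̄(k+1) ≤ r̄(k) − (α/(4C²)) r̄(k)². -/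

import Mathlib

open scoped RealInnerProductSpace

lemma aux_abs {H : Type*} [NormedAddCommGroup H] [InnerProductSpace ℝ H] (F : H → ℝ) (G : H → H)
    (lo : ∀ x y, F x + ⟪G x, y - x⟫ ≤ F y)
    (up : ∀ x y, F y ≤ F x + ⟪G x, y - x⟫ + ‖y - x‖ ^ 2) (m : H) (hm : ∀ z, F m ≤ F z) (x : H) :
    F (x - G x) ≤ F x ∧ ‖x - G x - m‖ ≤ ‖x - m‖ := by
  constructor
  · have := up x (x - G x)
    rw [show x - G x - x = - G x by abel, inner_neg_right, real_inner_self_eq_norm_sq, norm_neg] at this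
    linarith
  · have h1 := up x (x - (1/2:ℝ) • G x)
    rw [show x - (1/2:ℝ) • G x - x = (-(1/2:ℝ)) • G x by module, inner_smul_right,
      real_inner_self_eq_norm_sq, norm_smul, mul_pow] at h1
    have h0 : G m = 0 := by
      have h := up m (m - (1/2:ℝ) • G m)
      rw [show m - (1/2:ℝ) • G m - m = (-(1/2:ℝ)) • G m by module, inner_smul_right,
        real_inner_self_eq_norm_sq, norm_smul, mul_pow] at h
      have h2 := hm (m - (1/2:ℝ) • G m)
      norm_num at h
      have : ‖G m‖ ^ 2 ≤ 0 := by linarith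
      have : ‖G m‖ = 0 := by nlinarith [norm_nonneg (G m)]
      simpa using this
    have h2 := hm (x - (1/2:ℝ) • G x)
    have h3 := up m (m + (1/2:ℝ) • G x)
    have h4 := lo x (m + (1/2:ℝ) • G x)
    rw [h0, inner_zero_left, show m + (1/2:ℝ) • G x - m = (1/2:ℝ) • G x by module,
      norm_smul, mul_pow] at h3
    rw [show m + (1/2:ℝ) • G x - x = (1/2:ℝ) • G x - (x - m) by module, inner_sub_right,
      inner_smul_right, real_inner_self_eq_norm_sq] at h4
    have h5 : ‖x - G x - m‖ ^ 2 = ‖x - m‖ ^ 2 - 2 * ⟪G x, x - m⟫ + ‖G x‖ ^ 2 := by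
      rw [show x - G x - m = (x - m) - G x by abel, norm_sub_sq_real, real_inner_comm]
    norm_num at h1 h3 h4
    apply le_of_sq_le_sq _ (norm_nonneg _)
    rw [h5]; linarith

section
variable {E : Type*} [NormedAddCommGroup E] [InnerProductSpace ℝ E] [CompleteSpace E]

lemma aux_line {f : E → ℝ} {g : E → E} (hg : ∀ z, HasGradientAt f (g z) z) (x d : E) (t : ℝ) :
    HasDerivAt (fun t : ℝ => f (x + t • d)) ⟪g (x + t • d), d⟫ t := by
  have h1 : HasDerivAt (fun t : ℝ => x + t • d) d t := by
    simpa using ((hasDerivAt_id t).smul_const d).const_add x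
  have := (hg (x + t • d)).hasFDerivAt.comp_hasDerivAt t h1
  simp only [InnerProductSpace.toDual_apply_apply] at this
  exact this

lemma aux_lo {f : E → ℝ} {g : E → E} (hg : ∀ z, HasGradientAt f (g z) z)
    (hc : ConvexOn ℝ Set.univ f) (x y : E) : f x + ⟪g x, y - x⟫ ≤ f y := by
  have hd := aux_line hg x (y - x) 0
  have hc' : ConvexOn ℝ Set.univ (fun t : ℝ => f (x + t • (y - x))) := by
    have := hc.comp_affineMap (AffineMap.lineMap x y : ℝ →ᵃ[ℝ] E)
    have e : (fun t : ℝ => f (x + t • (y - x))) = f ∘ (AffineMap.lineMap x y : ℝ →ᵃ[ℝ] E) := by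
      funext t
      simp [AffineMap.lineMap_apply, add_comm]
    rw [e]
    exact this
  have := hc'.le_slope_of_hasDerivAt (Set.mem_univ 0) (Set.mem_univ 1) one_pos hd
  simp [slope_def_field] at this
  linarith

lemma aux_up {f : E → ℝ} {g : E → E} (hg : ∀ z, HasGradientAt f (g z) z) {L : ℝ} (hL : 0 < L)
    (hl : LipschitzWith L.toNNReal g) (x y : E) :
    f y ≤ f x + ⟪g x, y - x⟫ + L / 2 * ‖y - x‖ ^ 2 := by
  set d := y - x with hd
  have hD : ∀ t : ℝ, HasDerivAt (fun t : ℝ => f (x + t • d) - t * ⟪g x, d⟫ - L / 2 * ‖d‖ ^ 2 * t ^ 2)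
      (⟪g (x + t • d), d⟫ - ⟪g x, d⟫ - L / 2 * ‖d‖ ^ 2 * (2 * t)) t := by
    intro t
    have h2 := ((hasDerivAt_id t).mul_const ⟪g x, d⟫)
    have h3 := ((hasDerivAt_pow 2 t).const_mul (L / 2 * ‖d‖ ^ 2))
    have h4 := ((aux_line hg x d t).sub h2).sub h3
    simp only [one_mul, Nat.cast_ofNat, Nat.add_one_sub_one, pow_one] at h4
    exact h4
  have ha : AntitoneOn (fun t : ℝ => f (x + t • d) - t * ⟪g x, d⟫ - L / 2 * ‖d‖ ^ 2 * t ^ 2)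
      (Set.Icc 0 1) := by
    apply antitoneOn_of_deriv_nonpos (convex_Icc 0 1)
    · exact fun t _ => (hD t).continuousAt.continuousWithinAt
    · exact fun t _ => (hD t).differentiableAt.differentiableWithinAt
    · intro t ht
      rw [interior_Icc] at ht
      rw [(hD t).deriv, ← inner_sub_left]
      have h1 := real_inner_le_norm (g (x + t • d) - g x) d
      have h2 := hl.dist_le_mul (x + t • d) x
      rw [dist_eq_norm, dist_eq_norm, Real.coe_toNNReal _ hL.le, add_sub_cancel_left, norm_smul,
        Real.norm_of_nonneg ht.1.le] at h2
      nlinarith [norm_nonneg d]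
  have := ha (Set.left_mem_Icc.2 zero_le_one) (Set.right_mem_Icc.2 zero_le_one) zero_le_one
  simp [hd] at this
  linarith

lemma aux_gradbd {f : E → ℝ} {g : E → E} (hg : ∀ z, HasGradientAt f (g z) z) {L : ℝ} (hL : 0 < L)
    (hl : LipschitzWith L.toNNReal g) (hb : BddBelow (Set.range f)) (x : E) :
    ‖g x‖ ^ 2 ≤ 2 * L * (f x - ⨅ z, f z) := by
  have h := aux_up hg hL hl x (x - L⁻¹ • g x)
  have h1 := ciInf_le hb (x - L⁻¹ • g x)
  rw [show x - L⁻¹ • g x - x = (-L⁻¹) • g x by module, inner_smul_right,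
    real_inner_self_eq_norm_sq, norm_smul, mul_pow, Real.norm_eq_abs, sq_abs] at h
  have h2 : L * ((-L⁻¹) * ‖g x‖ ^ 2 + L / 2 * ((-L⁻¹) ^ 2 * ‖g x‖ ^ 2)) = - ‖g x‖ ^ 2 / 2 := by
    field_simp; ring
  nlinarith
end

section
variable {n p : ℕ} (W : Matrix (Fin n) (Fin n) ℝ) (hW : W.IsHermitian)
open Matrix

lemma aux_coef (v : EuclideanSpace ℝ (Fin n)) (j : Fin n) :
    ⟪hW.eigenvectorBasis j, WithLp.toLp 2 (W *ᵥ v.ofLp)⟫ =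
      hW.eigenvalues j * ⟪hW.eigenvectorBasis j, v⟫ := by
  have h := hW.mulVec_eigenvectorBasis j
  have hs : Wᵀ = W := by simpa using hW.eq
  have e : ∀ a b : EuclideanSpace ℝ (Fin n), ⟪a, b⟫ = b.ofLp ⬝ᵥ a.ofLp := by
    intro a b; simp [EuclideanSpace.inner_eq_star_dotProduct]
  rw [e, e]
  rw [dotProduct_comm, dotProduct_mulVec, ← mulVec_transpose, hs, h]
  simp [dotProduct_comm]

lemma aux_low (m : ℝ) (hm : ∀ j, m ≤ hW.eigenvalues j) (v : EuclideanSpace ℝ (Fin n)) :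
    m * ‖v‖ ^ 2 ≤ ⟪v, WithLp.toLp 2 (W *ᵥ v.ofLp)⟫ := by
  rw [← hW.eigenvectorBasis.sum_inner_mul_inner, ← hW.eigenvectorBasis.sum_sq_norm_inner_right v, Finset.mul_sum]
  apply Finset.sum_le_sum
  intro j _
  rw [aux_coef, real_inner_comm, Real.norm_eq_abs, sq_abs]
  nlinarith [hm j, sq_nonneg ⟪hW.eigenvectorBasis j, v⟫]

lemma aux_contr (hrow : ∀ i, ∑ j, W i j = 1) (b : ℝ) (j0 : Fin n) 
    (hb : ∀ j, j ≠ j0 → |hW.eigenvalues j| ≤ b) (hb1 : b < 1) (v : EuclideanSpace ℝ (Fin n))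
    (hv : ∑ i, v i = 0) :
    ‖WithLp.toLp 2 (W *ᵥ v.ofLp)‖ ^ 2 ≤ b ^ 2 * ‖v‖ ^ 2 := by
  let o : EuclideanSpace ℝ (Fin n) := WithLp.toLp 2 (fun _ => 1)
  have hWo : WithLp.toLp 2 (W *ᵥ o.ofLp) = o := by
    ext i; simp [o, mulVec, dotProduct, hrow]
  have hov : ⟪o, v⟫ = 0 := by
    simp [o, PiLp.inner_apply, hv]
  have hoj : ∀ j, j ≠ j0 → ⟪hW.eigenvectorBasis j, o⟫ = 0 := by
    intro j hj
    have h := aux_coef W hW o j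
    rw [hWo] at h
    have h2 := (abs_le.1 (hb j hj)).2
    have : (1 - hW.eigenvalues j) * ⟪hW.eigenvectorBasis j, o⟫ = 0 := by linarith
    rcases mul_eq_zero.1 this with h | h
    · linarith
    · exact h
  have ho0 : ⟪hW.eigenvectorBasis j0, o⟫ ≠ 0 := by
    intro h0
    have h := hW.eigenvectorBasis.sum_sq_norm_inner_right o
    rw [Finset.sum_eq_zero] at h
    · have : o = 0 := by simpa using h.symm
      have := congrArg (fun z : EuclideanSpace ℝ (Fin n) => z j0) this
      simp [o] at this
    · intro j _
      by_cases hj : j = j0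
      · simp [hj, h0]
      · simp [hoj j hj]
  have hv0 : ⟪hW.eigenvectorBasis j0, v⟫ = 0 := by
    have h := hW.eigenvectorBasis.sum_inner_mul_inner o v
    rw [hov, Finset.sum_eq_single j0] at h
    · rw [real_inner_comm] at h
      exact (mul_eq_zero.1 h).resolve_left ho0
    · intro j _ hj
      rw [real_inner_comm, hoj j hj, zero_mul]
    · simp
  rw [← hW.eigenvectorBasis.sum_sq_norm_inner_right, ← hW.eigenvectorBasis.sum_sq_norm_inner_right v, Finset.mul_sum]
  apply Finset.sum_le_sum
  intro j _
  rw [aux_coef, norm_mul, mul_pow]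
  by_cases hj : j = j0
  · simp [hj, hv0]
  · have := hb j hj
    gcongr
    simpa using this

lemma aux_low' (m : ℝ) (hm : ∀ j, m ≤ hW.eigenvalues j) (y : Fin n → EuclideanSpace ℝ (Fin p)) :
    m * ∑ i, ‖y i‖ ^ 2 ≤ ∑ i, ⟪y i, ∑ j, W i j • y j⟫ := by
  have h : ∀ c, m * ∑ i, (y i c) ^ 2 ≤ ∑ i, y i c * ∑ j, W i j * y j c := by
    intro c
    have := aux_low W hW m hm (WithLp.toLp 2 (fun i => y i c))
    simpa [EuclideanSpace.norm_sq_eq, PiLp.inner_apply, mulVec, dotProduct, mul_comm] using this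
  have := Finset.sum_le_sum (s := Finset.univ) fun c _ => h c
  rw [← Finset.mul_sum, Finset.sum_comm] at this
  rw [Finset.sum_comm (f := fun c i => y i c * ∑ j, W i j * y j c)] at this
  simp only [EuclideanSpace.norm_sq_eq, Real.norm_eq_abs, sq_abs]
  refine this.trans (le_of_eq (Finset.sum_congr rfl fun i _ => ?_))
  simp [PiLp.inner_apply, mul_comm]

lemma aux_contr' (hrow : ∀ i, ∑ j, W i j = 1) (b : ℝ) (j0 : Fin n) 
    (hb : ∀ j, j ≠ j0 → |hW.eigenvalues j| ≤ b) (hb1 : b < 1) (y : Fin n → EuclideanSpace ℝ (Fin p))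
    (hy : ∑ i, y i = 0) :
    ∑ i, ‖∑ j, W i j • y j‖ ^ 2 ≤ b ^ 2 * ∑ i, ‖y i‖ ^ 2 := by
  have h : ∀ c, ∑ i, (∑ j, W i j * y j c) ^ 2 ≤ b ^ 2 * ∑ i, (y i c) ^ 2 := by
    intro c
    have := aux_contr W hW hrow b j0 hb hb1 (WithLp.toLp 2 (fun i => y i c)) (by
      have := congrArg (fun z : EuclideanSpace ℝ (Fin p) => z c) hy
      simpa using this)
    simpa [EuclideanSpace.norm_sq_eq, mulVec, dotProduct] using this
  have := Finset.sum_le_sum (s := Finset.univ) fun c _ => h c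
  rw [← Finset.mul_sum, Finset.sum_comm] at this
  rw [Finset.sum_comm (f := fun c i => (y i c) ^ 2)] at this
  simp only [EuclideanSpace.norm_sq_eq, Real.norm_eq_abs, sq_abs]
  refine le_trans (le_of_eq (Finset.sum_congr rfl fun i _ => ?_)) this
  simp

lemma aux_hi (hWs : W.IsHermitian) (hnn : ∀ i j, 0 ≤ W i j) (hrow : ∀ i, ∑ j, W i j = 1)
    (hcol : ∀ j, ∑ i, W i j = 1)
    (y : Fin n → EuclideanSpace ℝ (Fin p)) :
    ∑ i, ⟪y i, ∑ j, W i j • y j⟫ ≤ ∑ i, ‖y i‖ ^ 2 := by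
  have h : 0 ≤ ∑ i, ∑ j, W i j * ‖y i - y j‖ ^ 2 :=
    Finset.sum_nonneg fun i _ => Finset.sum_nonneg fun j _ => mul_nonneg (hnn i j) (sq_nonneg _)
  have e : ∀ i j, W i j * ‖y i - y j‖ ^ 2 =
      W i j * ‖y i‖ ^ 2 - 2 * ⟪y i, W i j • y j⟫ + W i j * ‖y j‖ ^ 2 := by
    intro i j; rw [norm_sub_sq_real, inner_smul_right]; ring
  simp only [e, Finset.sum_add_distrib, Finset.sum_sub_distrib, ← Finset.sum_mul, ← Finset.mul_sum,
    hrow, ← inner_sum] at h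
  rw [Finset.sum_comm (f := fun i j => W i j * ‖y j‖ ^ 2)] at h
  simp only [← Finset.sum_mul, hcol, one_mul] at h
  linarith
end

section
variable {n p : ℕ}

lemma aux_var {E : Type*} [NormedAddCommGroup E] [InnerProductSpace ℝ E] (hn : 0 < n)
    (v : Fin n → E) :
    ∑ i, ‖v i - (n : ℝ)⁻¹ • ∑ j, v j‖ ^ 2 = ∑ i, ‖v i‖ ^ 2 - n * ‖(n : ℝ)⁻¹ • ∑ j, v j‖ ^ 2 := by
  have hn' : (n : ℝ) ≠ 0 := by positivity
  set c := (n : ℝ)⁻¹ • ∑ j, v j with hc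
  have h1 : ∑ j, v j = (n : ℝ) • c := by rw [hc, smul_smul, mul_inv_cancel₀ hn', one_smul]
  simp only [norm_sub_sq_real, Finset.sum_add_distrib, Finset.sum_sub_distrib, ← Finset.mul_sum,
    ← sum_inner, h1, inner_smul_left, real_inner_self_eq_norm_sq]
  simp
  ring

lemma aux_quad (W : Matrix (Fin n) (Fin n) ℝ) (hW : W.IsHermitian)
    (x y : Fin n → EuclideanSpace ℝ (Fin p)) :
    ∑ i, ⟪y i, ∑ j, W i j • y j⟫ = ∑ i, ⟪x i, ∑ j, W i j • x j⟫
      + 2 * ∑ i, ⟪∑ j, W i j • x j, y i - x i⟫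
      + ∑ i, ⟪y i - x i, ∑ j, W i j • (y j - x j)⟫ := by
  have hs : ∀ i j, W i j = W j i := fun i j => by simpa using (hW.apply i j).symm
  have sy : ∀ a b : Fin n → EuclideanSpace ℝ (Fin p),
      ∑ i, ⟪a i, ∑ j, W i j • b j⟫ = ∑ i, ⟪b i, ∑ j, W i j • a j⟫ := by
    intro a b
    simp only [inner_sum, inner_smul_right]
    rw [Finset.sum_comm]
    refine Finset.sum_congr rfl fun i _ => Finset.sum_congr rfl fun j _ => ?_
    rw [hs, real_inner_comm]
  have h2 : ∑ i, ⟪∑ j, W i j • x j, y i - x i⟫ = ∑ i, ⟪y i, ∑ j, W i j • x j⟫ - ∑ i, ⟪x i, ∑ j, W i j • x j⟫ := by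
    rw [← Finset.sum_sub_distrib]
    refine Finset.sum_congr rfl fun i _ => ?_
    rw [real_inner_comm, inner_sub_left]
  have h3 := sy x y
  rw [h2]
  simp only [smul_sub, Finset.sum_sub_distrib, inner_sub_left, inner_sub_right]
  rw [h3]; ring

lemma aux_dev (hn : 0 < n) (W : Matrix (Fin n) (Fin n) ℝ) (hW : W.IsHermitian)
    (hrow : ∀ i, ∑ j, W i j = 1) (hcol : ∀ j, ∑ i, W i j = 1) (b : ℝ) (j0 : Fin n)
    (hb0 : 0 ≤ b)
    (hb : ∀ j, j ≠ j0 → |hW.eigenvalues j| ≤ b) (hb1 : b < 1)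
    (x g : ℕ → Fin n → EuclideanSpace ℝ (Fin p)) (α D : ℝ) (hα : 0 < α) (hD : 0 ≤ D)
    (hiter : ∀ k i, x (k + 1) i = (∑ j, W i j • x k j) - α • g k i) (hx0 : ∀ i, x 0 i = 0)
    (hg : ∀ k, ∑ i, ‖g k i‖ ^ 2 ≤ D ^ 2) :
    (∀ k, (n : ℝ)⁻¹ • ∑ i, x (k + 1) i = (n : ℝ)⁻¹ • ∑ i, x k i - α • ((n : ℝ)⁻¹ • ∑ i, g k i)) ∧
    ∀ k, ∑ i, ‖x k i - (n : ℝ)⁻¹ • ∑ j, x k j‖ ^ 2 ≤ (α * D / (1 - b)) ^ 2 := by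
  have hmean : ∀ k, (n : ℝ)⁻¹ • ∑ i, x (k + 1) i
      = (n : ℝ)⁻¹ • ∑ i, x k i - α • ((n : ℝ)⁻¹ • ∑ i, g k i) := by
    intro k
    simp only [hiter, Finset.sum_sub_distrib, ← Finset.smul_sum]
    rw [Finset.sum_comm]
    simp only [← Finset.sum_smul, hcol, one_smul]
    module
  refine ⟨hmean, ?_⟩
  have h1b : 0 < 1 - b := by linarith
  have hn' : (n : ℝ) ≠ 0 := by positivity
  let c : ℕ → EuclideanSpace ℝ (Fin p) := fun k => (n : ℝ)⁻¹ • ∑ j, x k j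
  let Y : ℕ → PiLp 2 (fun _ : Fin n => EuclideanSpace ℝ (Fin p)) :=
    fun k => WithLp.toLp 2 (fun i => x k i - c k)
  have hY : ∀ k, ‖Y k‖ ≤ α * D / (1 - b) := by
    intro k
    induction k with
    | zero =>
      have : Y 0 = 0 := by ext i; simp [Y, c, hx0]
      rw [this, norm_zero]; positivity
    | succ k ih =>
      let gm := (n : ℝ)⁻¹ • ∑ i, g k i
      let A : PiLp 2 (fun _ : Fin n => EuclideanSpace ℝ (Fin p)) :=
        WithLp.toLp 2 (fun i => ∑ j, W i j • (x k j - c k))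
      let B : PiLp 2 (fun _ : Fin n => EuclideanSpace ℝ (Fin p)) :=
        WithLp.toLp 2 (fun i => g k i - gm)
      have e : Y (k + 1) = A - α • B := by
        apply PiLp.ext
        intro i
        simp only [Y, A, B, c, PiLp.sub_apply, PiLp.smul_apply]
        rw [hmean, hiter]
        simp only [smul_sub, Finset.sum_sub_distrib, ← Finset.sum_smul, hrow, one_smul]
        simp only [gm]
        abel
      have hA : ‖A‖ ≤ b * ‖Y k‖ := by
        apply le_of_sq_le_sq _ (by positivity)
        rw [mul_pow, PiLp.norm_sq_eq_of_L2, PiLp.norm_sq_eq_of_L2]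
        refine aux_contr' W hW hrow b j0 hb hb1 (fun i => x k i - c k) ?_
        simp [c, Finset.sum_sub_distrib, ← Nat.cast_smul_eq_nsmul ℝ, smul_smul, hn']
      have hB : ‖B‖ ≤ D := by
        apply le_of_sq_le_sq _ hD
        rw [PiLp.norm_sq_eq_of_L2]
        have := aux_var hn (g k)
        refine le_trans (le_of_eq this) (le_trans ?_ (hg k))
        have : 0 ≤ (n : ℝ) * ‖(n : ℝ)⁻¹ • ∑ j, g k j‖ ^ 2 := by positivity
        linarith
      calc ‖Y (k + 1)‖ ≤ ‖A‖ + ‖α • B‖ := by rw [e]; exact norm_sub_le _ _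
        _ ≤ b * (α * D / (1 - b)) + α * D := by
          rw [norm_smul, Real.norm_of_nonneg hα.le]
          gcongr
          exact hA.trans (by gcongr)
        _ = α * D / (1 - b) := by field_simp; ring
  intro k
  have := pow_le_pow_left₀ (norm_nonneg _) (hY k) 2
  rwa [PiLp.norm_sq_eq_of_L2] at this
end

theorem mean_objective_error_recursion
    {n p : ℕ} (hn : 0 < n)
    (f : Fin n → EuclideanSpace ℝ (Fin p) → ℝ)
    (gf : Fin n → EuclideanSpace ℝ (Fin p) → EuclideanSpace ℝ (Fin p))
    (Lf : Fin n → ℝ) (hLfpos : ∀ i, 0 < Lf i)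
    (hconv : ∀ i, ConvexOn ℝ Set.univ (f i))
    (hbdd : ∀ i, BddBelow (Set.range (f i)))
    (hgrad : ∀ i z, HasGradientAt (f i) (gf i z) z)
    (hlip : ∀ i, LipschitzWith (Lf i).toNNReal (gf i))
    (Lh : ℝ) (hLh : Lh = ⨆ i, Lf i)
    (W : Matrix (Fin n) (Fin n) ℝ)
    (hWsymm : W.IsHermitian)
    (hWnonneg : ∀ i j, 0 ≤ W i j)
    (hWrow : ∀ i, ∑ j, W i j = 1)
    (hWcol : ∀ j, ∑ i, W i j = 1)
    (lam : Fin n → ℝ) (hlamAnti : Antitone lam)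
    (hlamEig : ∃ σ : Equiv.Perm (Fin n), lam = hWsymm.eigenvalues ∘ σ)
    (hlam1 : lam ⟨0, hn⟩ = 1)
    (lamN : ℝ) (hlamN : lamN = lam ⟨n - 1, Nat.sub_lt hn Nat.one_pos⟩)
    (hlamNlb : -1 ≤ lamN)
    (β : ℝ) (hβdef : β = ⨆ j : {j : Fin n // j ≠ (⟨0, hn⟩ : Fin n)}, |lam j.1|)
    (α : ℝ) (hα : 0 < α)
    (x : ℕ → Fin n → EuclideanSpace ℝ (Fin p))
    (hiter : ∀ k i, x (k + 1) i = (∑ j, W i j • x k j) - α • gf i (x k i))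
    (hx0 : ∀ i, x 0 i = 0)
    (ξ : (Fin n → EuclideanSpace ℝ (Fin p)) → ℝ)
    (hξ : ∀ y, ξ y = -(1/2) * (∑ i, ∑ j, W i j * ⟪y i, y j⟫)
        + ∑ i, ((1/2) * ‖y i‖ ^ 2 + α * f i (y i)))
    (D : ℝ) (hD : D = Real.sqrt (2 * Lh * ((∑ i, f i 0) - ∑ i, ⨅ z, f i z)))
    (xbar : ℕ → EuclideanSpace ℝ (Fin p)) (hxbar : ∀ k, xbar k = (n : ℝ)⁻¹ • ∑ i, x k i)
    (fbar : EuclideanSpace ℝ (Fin p) → ℝ) (hfbar : ∀ z, fbar z = (n : ℝ)⁻¹ * ∑ i, f i z)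
    (Lfbar : ℝ) (hLfbar : Lfbar = (n : ℝ)⁻¹ * ∑ i, Lf i)
    (xt : Fin n → EuclideanSpace ℝ (Fin p)) (hxt : ∀ z, ξ xt ≤ ξ z)
    (Xstar : Set (EuclideanSpace ℝ (Fin p)))
    (hXstar : Xstar = {z | ∀ w, ∑ i, f i z ≤ ∑ i, f i w})
    (hXne : Xstar.Nonempty)
    (xstar : EuclideanSpace ℝ (Fin p)) (hxstarmem : xstar ∈ Xstar)
    (rbar : ℕ → ℝ) (hrbar : ∀ k, rbar k = fbar (xbar k) - fbar xstar)
    (C : ℝ)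
    (hC : C = (Real.sqrt n)⁻¹ *
      (Real.sqrt (∑ i, ‖xt i‖ ^ 2) + Real.sqrt (∑ i, ‖xt i - xstar‖ ^ 2)))
    (hstep : α ≤ min ((1 + lamN) / Lh) (1 / Lfbar))
    (hβlt : β < 1)
 :
    (∀ k, rbar (k + 1)
      ≤ rbar k - (α / (2 * C ^ 2)) * rbar k ^ 2 + α ^ 3 * D ^ 2 * Lh ^ 2 / (2 * (1 - β) ^ 2))
    ∧ (∀ k, rbar k > C * Real.sqrt 2 * (α * Lh * D / (1 - β)) →
        rbar (k + 1) ≤ rbar k - (α / (4 * C ^ 2)) * rbar k ^ 2) := by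
  have hn' : (0 : ℝ) < n := by exact_mod_cast hn
  haveI : Nonempty (Fin n) := ⟨⟨0, hn⟩⟩
  obtain ⟨σ, hσ⟩ := hlamEig
  have hLfle : ∀ i, Lf i ≤ Lh := fun i => hLh ▸ le_ciSup (Set.finite_range Lf).bddAbove i
  have hLhpos : 0 < Lh := lt_of_lt_of_le (hLfpos ⟨0, hn⟩) (hLfle _)
  have hLfbarpos : 0 < Lfbar := by
    rw [hLfbar]
    exact mul_pos (inv_pos.2 hn') (Finset.sum_pos (fun i _ => hLfpos i) Finset.univ_nonempty)
  have hs1 : α * Lh ≤ 1 + lamN := (le_div_iff₀ hLhpos).1 (hstep.trans (min_le_left _ _))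
  have hs2 : α * Lfbar ≤ 1 := (le_div_iff₀ hLfbarpos).1 (hstep.trans (min_le_right _ _))
  have hev : ∀ j, hWsymm.eigenvalues j = lam (σ.symm j) := by intro j; simp [hσ]
  have hlow : ∀ j, lamN ≤ hWsymm.eigenvalues j := by
    intro j
    rw [hev, hlamN]
    apply hlamAnti
    rw [Fin.le_def]
    have := (σ.symm j).2
    simp only
    omega
  have hβ0 : 0 ≤ β := by rw [hβdef]; exact Real.iSup_nonneg fun j => abs_nonneg _
  have hβb : ∀ j, j ≠ σ ⟨0, hn⟩ → |hWsymm.eigenvalues j| ≤ β := by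
    intro j hj
    have hj' : σ.symm j ≠ ⟨0, hn⟩ := fun h => hj (by rw [← h]; simp)
    rw [hev, hβdef]
    exact le_ciSup (f := fun j : {j : Fin n // j ≠ (⟨0, hn⟩ : Fin n)} => |lam j.1|)
      (Set.finite_range _).bddAbove ⟨σ.symm j, hj'⟩
  have hξ' : ∀ y : Fin n → EuclideanSpace ℝ (Fin p), ξ y =
      1/2 * (∑ i, ‖y i‖ ^ 2 - ∑ i, ⟪y i, ∑ j, W i j • y j⟫) + α * ∑ i, f i (y i) := by
    intro y
    rw [hξ]
    simp only [inner_sum, inner_smul_right, Finset.sum_add_distrib, ← Finset.mul_sum]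
    ring
  -- the gradient of the penalty function
  let G : PiLp 2 (fun _ : Fin n => EuclideanSpace ℝ (Fin p)) →
      PiLp 2 (fun _ : Fin n => EuclideanSpace ℝ (Fin p)) :=
    fun y => WithLp.toLp 2 (fun i => y i - ∑ j, W i j • y j + α • gf i (y i))
  have hbreg : ∀ a b : PiLp 2 (fun _ : Fin n => EuclideanSpace ℝ (Fin p)),
      ξ b.ofLp = ξ a.ofLp + ⟪G a, b - a⟫
        + (1/2 * (‖b - a‖ ^ 2 - ∑ i, ⟪b i - a i, ∑ j, W i j • (b j - a j)⟫)
        + α * ∑ i, (f i (b i) - f i (a i) - ⟪gf i (a i), b i - a i⟫)) := by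
    intro a b
    have hq := aux_quad W hWsymm a.ofLp b.ofLp
    have hi : ⟪G a, b - a⟫ = ∑ i, ⟪a i, b i - a i⟫ - ∑ i, ⟪∑ j, W i j • a j, b i - a i⟫
        + α * ∑ i, ⟪gf i (a i), b i - a i⟫ := by
      rw [PiLp.inner_apply, Finset.mul_sum, ← Finset.sum_sub_distrib, ← Finset.sum_add_distrib]
      refine Finset.sum_congr rfl fun i _ => ?_
      simp only [G, PiLp.sub_apply, inner_add_left, inner_sub_left, inner_smul_left]
      simp
    have hnn : ∑ i, ‖b i‖ ^ 2 = ∑ i, ‖a i‖ ^ 2 + 2 * ∑ i, ⟪a i, b i - a i⟫ + ‖b - a‖ ^ 2 := by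
      rw [PiLp.norm_sq_eq_of_L2, Finset.mul_sum, ← Finset.sum_add_distrib, ← Finset.sum_add_distrib]
      refine Finset.sum_congr rfl fun i _ => ?_
      rw [PiLp.sub_apply, ← norm_add_sq_real, add_sub_cancel]
    rw [hξ', hξ', hi, hq, hnn]
    simp only [Finset.sum_sub_distrib]
    ring
  have hlo : ∀ a b : PiLp 2 (fun _ : Fin n => EuclideanSpace ℝ (Fin p)),
      ξ a.ofLp + ⟪G a, b - a⟫ ≤ ξ b.ofLp := by
    intro a b
    rw [hbreg a b]
    have h1 := aux_hi W hWsymm hWnonneg hWrow hWcol (fun i => b i - a i)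
    have h2 : 0 ≤ ∑ i, (f i (b i) - f i (a i) - ⟪gf i (a i), b i - a i⟫) :=
      Finset.sum_nonneg fun i _ => by linarith [aux_lo (hgrad i) (hconv i) (a i) (b i)]
    have h3 : ‖b - a‖ ^ 2 = ∑ i, ‖b i - a i‖ ^ 2 := by rw [PiLp.norm_sq_eq_of_L2]; rfl
    have h4 := mul_nonneg hα.le h2
    rw [h3]
    linarith
  have hup : ∀ a b : PiLp 2 (fun _ : Fin n => EuclideanSpace ℝ (Fin p)),
      ξ b.ofLp ≤ ξ a.ofLp + ⟪G a, b - a⟫ + ‖b - a‖ ^ 2 := by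
    intro a b
    rw [hbreg a b]
    have h1 := aux_low' W hWsymm lamN hlow (fun i => b i - a i)
    have h3 : ‖b - a‖ ^ 2 = ∑ i, ‖b i - a i‖ ^ 2 := by rw [PiLp.norm_sq_eq_of_L2]; rfl
    have h2 : ∑ i, (f i (b i) - f i (a i) - ⟪gf i (a i), b i - a i⟫)
        ≤ Lh / 2 * ∑ i, ‖b i - a i‖ ^ 2 := by
      rw [Finset.mul_sum]
      refine Finset.sum_le_sum fun i _ => ?_
      have := aux_up (hgrad i) (hLfpos i) (hlip i) (a i) (b i)
      nlinarith [hLfle i, sq_nonneg ‖b i - a i‖]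
    rw [h3]
    have h5 : 0 ≤ ∑ i, ‖b i - a i‖ ^ 2 := Finset.sum_nonneg fun i _ => sq_nonneg _
    have h4 := mul_le_mul_of_nonneg_left h2 hα.le
    have h6 := mul_le_mul_of_nonneg_right hs1 h5
    linarith
  let X : ℕ → PiLp 2 (fun _ : Fin n => EuclideanSpace ℝ (Fin p)) := fun k => WithLp.toLp 2 (x k)
  let M : PiLp 2 (fun _ : Fin n => EuclideanSpace ℝ (Fin p)) := WithLp.toLp 2 xt
  have hXs : ∀ k, X (k + 1) = X k - G (X k) := by
    intro k
    apply PiLp.ext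
    intro i
    simp only [X, G, PiLp.sub_apply]
    rw [hiter]
    abel
  have hstepx := fun k => aux_abs (fun y => ξ y.ofLp) G hlo hup M (fun z => hxt _) (X k)
  have hdec : ∀ k, ξ (x k) ≤ ξ (x 0) := by
    intro k
    induction k with
    | zero => exact le_rfl
    | succ k ih =>
      have h := (hstepx k).1
      rw [← hXs] at h
      exact le_trans h ih
  have hdist : ∀ k, ‖X k - M‖ ≤ ‖M‖ := by
    intro k
    induction k with
    | zero =>
      have : X 0 = 0 := by apply PiLp.ext; intro i; simp [X, hx0]
      rw [this, zero_sub, norm_neg]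
    | succ k ih =>
      have h := (hstepx k).2
      rw [← hXs] at h
      exact h.trans ih
  -- gradient bound
  have hDpos : 0 ≤ D := by rw [hD]; exact Real.sqrt_nonneg _
  have hDsq : ∀ k, ∑ i, ‖gf i (x k i)‖ ^ 2 ≤ D ^ 2 := by
    intro k
    have h1 := hdec k
    rw [hξ', hξ'] at h1
    have h2 := aux_hi W hWsymm hWnonneg hWrow hWcol (x k)
    have h3 : ∑ i, f i (x k i) ≤ ∑ i, f i 0 := by
      simp only [hx0] at h1
      simp at h1
      have : α * ∑ i, f i (x k i) ≤ α * ∑ i, f i 0 := by linarith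
      exact le_of_mul_le_mul_left this hα
    have h4 : ∑ i, ‖gf i (x k i)‖ ^ 2 ≤ 2 * Lh * ((∑ i, f i 0) - ∑ i, ⨅ z, f i z) := by
      calc ∑ i, ‖gf i (x k i)‖ ^ 2 ≤ ∑ i, 2 * Lh * (f i (x k i) - ⨅ z, f i z) := by
            refine Finset.sum_le_sum fun i _ => ?_
            have h5 := aux_gradbd (hgrad i) (hLfpos i) (hlip i) (hbdd i) (x k i)
            have h6 := ciInf_le (hbdd i) (x k i)
            nlinarith [hLfle i]
        _ = 2 * Lh * ((∑ i, f i (x k i)) - ∑ i, ⨅ z, f i z) := by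
            rw [← Finset.mul_sum, Finset.sum_sub_distrib]
        _ ≤ _ := by gcongr
    rw [hD, Real.sq_sqrt]
    · exact h4
    · exact le_trans (Finset.sum_nonneg fun i _ => sq_nonneg _) h4
  obtain ⟨hmean, hdev⟩ := aux_dev hn W hWsymm hWrow hWcol β (σ ⟨0, hn⟩) hβ0 hβb hβlt x
    (fun k i => gf i (x k i)) α D hα hDpos hiter hx0 hDsq
  simp only [← hxbar] at hmean hdev
  have h1β : 0 < 1 - β := by linarith
  have hjens : ∀ v : Fin n → EuclideanSpace ℝ (Fin p),
      n * ‖(n : ℝ)⁻¹ • ∑ j, v j‖ ^ 2 ≤ ∑ i, ‖v i‖ ^ 2 := by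
    intro v
    have h := aux_var hn v
    have : 0 ≤ ∑ i, ‖v i - (n : ℝ)⁻¹ • ∑ j, v j‖ ^ 2 := Finset.sum_nonneg fun i _ => sq_nonneg _
    linarith
  -- error of the mean gradient
  let gb : ℕ → EuclideanSpace ℝ (Fin p) := fun k => (n : ℝ)⁻¹ • ∑ i, gf i (xbar k)
  let gt : ℕ → EuclideanSpace ℝ (Fin p) := fun k => (n : ℝ)⁻¹ • ∑ i, gf i (x k i)
  have hn1 : (1 : ℝ) ≤ n := by exact_mod_cast hn
  have herr : ∀ k, ‖gt k - gb k‖ ^ 2 ≤ (α * D * Lh / (1 - β)) ^ 2 := by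
    intro k
    have h1 := hjens (fun i => gf i (x k i) - gf i (xbar k))
    have h2 : ∑ i, ‖gf i (x k i) - gf i (xbar k)‖ ^ 2 ≤ Lh ^ 2 * ∑ i, ‖x k i - xbar k‖ ^ 2 := by
      rw [Finset.mul_sum]
      refine Finset.sum_le_sum fun i _ => ?_
      have h := (hlip i).dist_le_mul (x k i) (xbar k)
      rw [dist_eq_norm, dist_eq_norm, Real.coe_toNNReal _ (hLfpos i).le] at h
      rw [← mul_pow]
      have := hLfle i
      refine pow_le_pow_left₀ (norm_nonneg _) (h.trans ?_) 2
      gcongr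
    have h3 := mul_le_mul_of_nonneg_left (hdev k) (sq_nonneg Lh)
    have h4 : gt k - gb k = (n : ℝ)⁻¹ • ∑ i, (gf i (x k i) - gf i (xbar k)) := by
      simp only [gt, gb, Finset.sum_sub_distrib, smul_sub]
    rw [← h4] at h1
    have h5 : Lh ^ 2 * (α * D / (1 - β)) ^ 2 = (α * D * Lh / (1 - β)) ^ 2 := by ring
    nlinarith [sq_nonneg ‖gt k - gb k‖]
  -- distance of the mean to the optimum
  have hsqn : 0 < Real.sqrt n := Real.sqrt_pos.2 hn'
  have hC0 : 0 ≤ C := by rw [hC]; positivity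
  have hCd : ∀ k, ‖xbar k - xstar‖ ≤ C := by
    intro k
    let S : PiLp 2 (fun _ : Fin n => EuclideanSpace ℝ (Fin p)) := WithLp.toLp 2 (fun _ => xstar)
    have h1 := hjens (fun i => x k i - xstar)
    have h2 : (n : ℝ)⁻¹ • ∑ i, (x k i - xstar) = xbar k - xstar := by
      simp [hxbar, Finset.sum_sub_distrib, smul_sub, ← Nat.cast_smul_eq_nsmul ℝ, smul_smul, hn'.ne']
    rw [h2] at h1
    have h3 : ‖X k - S‖ ^ 2 = ∑ i, ‖x k i - xstar‖ ^ 2 := by rw [PiLp.norm_sq_eq_of_L2]; rfl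
    have h4 : ‖X k - S‖ ≤ ‖M‖ + ‖M - S‖ :=
      (norm_sub_le_norm_sub_add_norm_sub (X k) M S).trans (by gcongr; exact hdist k)
    have h5 : ‖M‖ = Real.sqrt (∑ i, ‖xt i‖ ^ 2) := by rw [PiLp.norm_eq_of_L2]
    have h6 : ‖M - S‖ = Real.sqrt (∑ i, ‖xt i - xstar‖ ^ 2) := by rw [PiLp.norm_eq_of_L2]; rfl
    rw [hC, ← h5, ← h6, inv_mul_eq_div, le_div_iff₀ hsqn]
    refine le_trans ?_ h4
    apply le_of_sq_le_sq _ (norm_nonneg _)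
    rw [mul_pow, Real.sq_sqrt hn'.le, h3]
    linarith
  -- descent
  have hfup : ∀ a b, fbar b ≤ fbar a + ⟪(n : ℝ)⁻¹ • ∑ i, gf i a, b - a⟫
      + Lfbar / 2 * ‖b - a‖ ^ 2 := by
    intro a b
    have h : ∑ i, f i b ≤ ∑ i, (f i a + ⟪gf i a, b - a⟫ + Lf i / 2 * ‖b - a‖ ^ 2) :=
      Finset.sum_le_sum fun i _ => aux_up (hgrad i) (hLfpos i) (hlip i) a b
    rw [Finset.sum_add_distrib, Finset.sum_add_distrib, ← Finset.sum_mul, ← Finset.sum_div,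
      ← sum_inner] at h
    have h' := mul_le_mul_of_nonneg_left h (inv_pos.2 hn').le
    rw [hfbar, hfbar, hLfbar, real_inner_smul_left]
    linarith
  have hflo : ∀ a b, fbar a + ⟪(n : ℝ)⁻¹ • ∑ i, gf i a, b - a⟫ ≤ fbar b := by
    intro a b
    have h : ∑ i, (f i a + ⟪gf i a, b - a⟫) ≤ ∑ i, f i b :=
      Finset.sum_le_sum fun i _ => aux_lo (hgrad i) (hconv i) a b
    rw [Finset.sum_add_distrib, ← sum_inner] at h
    have h' := mul_le_mul_of_nonneg_left h (inv_pos.2 hn').le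
    rw [hfbar, hfbar, real_inner_smul_left]
    linarith
  have hdesc : ∀ k, rbar (k + 1) ≤ rbar k - α / 2 * ‖gb k‖ ^ 2 + α / 2 * ‖gt k - gb k‖ ^ 2 := by
    intro k
    have h := hfup (xbar k) (xbar (k + 1))
    have e : xbar (k + 1) - xbar k = (-α) • gt k := by rw [hmean k]; simp only [gt]; module
    rw [e, norm_smul, mul_pow, Real.norm_eq_abs, sq_abs, inner_smul_right] at h
    have h2 : ‖gt k - gb k‖ ^ 2 = ‖gt k‖ ^ 2 - 2 * ⟪gb k, gt k⟫ + ‖gb k‖ ^ 2 := by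
      rw [norm_sub_sq_real, real_inner_comm]
    have h3 : Lfbar / 2 * ((-α) ^ 2 * ‖gt k‖ ^ 2) ≤ α / 2 * ‖gt k‖ ^ 2 := by
      have := mul_le_mul_of_nonneg_right hs2 (mul_nonneg hα.le (sq_nonneg ‖gt k‖))
      linarith
    rw [hrbar, hrbar, h2]
    change _ ≤ fbar (xbar k) + -α * ⟪gb k, gt k⟫ + _ at h
    linarith
  have hr0 : ∀ k, 0 ≤ rbar k := by
    intro k
    rw [hXstar] at hxstarmem
    have h := mul_le_mul_of_nonneg_left (hxstarmem (xbar k)) (inv_pos.2 hn').le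
    rw [hrbar, hfbar, hfbar]
    linarith
  have hrC : ∀ k, rbar k ≤ ‖gb k‖ * C := by
    intro k
    have h := hflo (xbar k) xstar
    have h2 : ⟪gb k, xbar k - xstar⟫ ≤ ‖gb k‖ * ‖xbar k - xstar‖ := real_inner_le_norm _ _
    have h3 := mul_le_mul_of_nonneg_left (hCd k) (norm_nonneg (gb k))
    have h4 : ⟪gb k, xstar - xbar k⟫ = - ⟪gb k, xbar k - xstar⟫ := by
      rw [← inner_neg_right, neg_sub]
    change fbar (xbar k) + ⟪gb k, xstar - xbar k⟫ ≤ _ at h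
    rw [hrbar]
    linarith
  have hmain : ∀ k, rbar (k + 1)
      ≤ rbar k - (α / (2 * C ^ 2)) * rbar k ^ 2
        + α ^ 3 * D ^ 2 * Lh ^ 2 / (2 * (1 - β) ^ 2) := by
    intro k
    have h1 := hdesc k
    have h2 := mul_le_mul_of_nonneg_left (herr k) (half_pos hα).le
    have h3 : α / 2 * (α * D * Lh / (1 - β)) ^ 2
        = α ^ 3 * D ^ 2 * Lh ^ 2 / (2 * (1 - β) ^ 2) := by
      field_simp
    have h4 : (α / (2 * C ^ 2)) * rbar k ^ 2 ≤ α / 2 * ‖gb k‖ ^ 2 := by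
      rcases hC0.eq_or_lt with h | h
      · rw [← h]; simp; positivity
      · have h5 := pow_le_pow_left₀ (hr0 k) (hrC k) 2
        rw [div_mul_eq_mul_div, div_le_iff₀ (by positivity)]
        nlinarith
    linarith
  refine ⟨hmain, ?_⟩
  intro k hk
  have h1 := hmain k
  have hCpos : 0 < C := by
    rcases hC0.eq_or_lt with h | h
    · have := hrC k
      rw [← h] at this hk
      simp at this hk
      linarith
    · exact h
  have h2 := pow_le_pow_left₀ (by positivity) hk.le 2
  have h3 : (C * Real.sqrt 2 * (α * Lh * D / (1 - β))) ^ 2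
      = 2 * C ^ 2 * (α * Lh * D / (1 - β)) ^ 2 := by
    rw [mul_pow, mul_pow, Real.sq_sqrt (by norm_num)]; ring
  rw [h3] at h2
  have h4 := mul_le_mul_of_nonneg_left h2 (by positivity : 0 ≤ α / (4 * C ^ 2))
  have h5 : α / (4 * C ^ 2) * (2 * C ^ 2 * (α * Lh * D / (1 - β)) ^ 2)
      = α ^ 3 * D ^ 2 * Lh ^ 2 / (2 * (1 - β) ^ 2) := by
    field_simp
    ring
  have h6 : α / (2 * C ^ 2) * rbar k ^ 2 = 2 * (α / (4 * C ^ 2) * rbar k ^ 2) := by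
    field_simp
    ring
  linarith
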